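/- Let α be a timed transition system on a set X and let R be an equivalence relation on X with quotient map f : X → X/R. Then R is a weak time-abstract bisimulation for α if and only if there exists a map β : X/R → 𝒫(Σ_τ × X/R) that is saturated ((τ,y) ∈ β(y) for all y, and β ∘ β ≤ β pointwise under the Kleisli composition) such that f^♯ ∘ W = β ∘ f^♯, where W : X → 𝒫(Σ_τ × X) is the time-abstract saturated step map W(x) = {(σ,y) | ∃ t ∈ 𝕋, x ⇒^{σ,t} y}. -/

import Mathlib

/- `Option Act` models `Σ_τ`: `none` is the silent label `τ`, `some a` is an action. -/

/-- Kleisli composition for the LTS monad: `kcomp g f` is `g ∘ f` (`f` applied first). -/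
def kcomp {Act X Y Z : Type*} (g : Y → Set (Option Act × Z)) (f : X → Set (Option Act × Y)) :
    X → Set (Option Act × Z) := fun x =>
  {p | ∃ y : Y, ((p.1, y) ∈ f x ∧ ((none, p.2) : Option Act × Z) ∈ g y) ∨
        (((none, y) : Option Act × Y) ∈ f x ∧ (p.1, p.2) ∈ g y)}

/-- Kleisli lifting `f^♯(x) = {(τ, f x)}` of a function `f`. -/
def fsharp {Act X Y : Type*} (f : X → Y) : X → Set (Option Act × Y) :=
  fun x => {((none : Option Act), f x)}

/-- The saturated step relation `x ⇒^{σ,t} y`: the least relation containing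
`x ⇒^{τ,0} x` and closed under `x ⇒^{τ,t₀} x' →^{σ,t₁} y' ⇒^{τ,t₂} y ⟹ x ⇒^{σ,t₀+t₁+t₂} y`. -/
inductive WStep {Act T X : Type*} [AddCommMonoid T]
    (α : X → Set (Option Act × T × X)) : X → Option Act → T → X → Prop
  | refl (x : X) : WStep α x none 0 x
  | step {x x' y' y : X} {σ : Option Act} {t₀ t₁ t₂ : T} :
      WStep α x none t₀ x' → (σ, t₁, y') ∈ α x' → WStep α y' none t₂ y →
      WStep α x σ (t₀ + t₁ + t₂) y

/-- `R` is a weak time-abstract bisimulation for the TTS `α`. -/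
def WeakTimeAbstractBisim {Act T X : Type*} [AddCommMonoid T]
    (α : X → Set (Option Act × T × X)) (R : X → X → Prop) : Prop :=
  ∀ x y, R x y → ∀ (σ : Option Act) (t : T) (x' : X),
    WStep α x σ t x' → ∃ y' t', WStep α y σ t' y' ∧ R x' y'

theorem WStep.trans_silent {Act T X : Type*} [AddCommMonoid T]
    {α : X → Set (Option Act × T × X)} {x y z : X} {σ : Option Act} {t s : T}
    (h : WStep α x σ t y) (hs : WStep α y none s z) : ∃ u, WStep α x σ u z := by
  induction h with
  | refl x => exact ⟨s, hs⟩
  | step h₀ h₁ _ _ ih =>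
    obtain ⟨u, hu⟩ := ih hs
    exact ⟨_, .step h₀ h₁ hu⟩

theorem WStep.silent_trans {Act T X : Type*} [AddCommMonoid T]
    {α : X → Set (Option Act × T × X)} {x y z : X} {σ : Option Act} {t s : T}
    (hs : WStep α x none s y) (h : WStep α y σ t z) : ∃ u, WStep α x σ u z := by
  cases h with
  | refl => exact ⟨s, hs⟩
  | step h₀ h₁ h₂ =>
    obtain ⟨u, hu⟩ := hs.trans_silent h₀
    exact ⟨_, .step hu h₁ h₂⟩

theorem mem_kcomp_fsharp_left {Act X Y : Type*} (f : X → Y) (W : X → Set (Option Act × X))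
    (x : X) (σ : Option Act) (z : Y) :
    (σ, z) ∈ kcomp (fsharp f) W x ↔ ∃ y, (σ, y) ∈ W x ∧ f y = z := by
  simp only [kcomp, fsharp, Set.mem_ofPred_eq, Set.mem_singleton_iff, Prod.mk.injEq, true_and]
  constructor
  · rintro ⟨y, ⟨h, rfl⟩ | ⟨h, rfl, rfl⟩⟩ <;> exact ⟨y, h, rfl⟩
  · rintro ⟨y, h, rfl⟩
    exact ⟨y, .inl ⟨h, rfl⟩⟩

theorem kcomp_fsharp_right {Act X Y Z : Type*} (f : X → Y) (β : Y → Set (Option Act × Z)) (x : X) :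
    kcomp β (fsharp f) x = β (f x) := by
  ext ⟨σ, z⟩
  simp only [kcomp, fsharp, Set.mem_ofPred_eq, Set.mem_singleton_iff, Prod.mk.injEq, true_and]
  constructor
  · rintro ⟨y, ⟨⟨rfl, rfl⟩, h⟩ | ⟨rfl, h⟩⟩ <;> exact h
  · exact fun h => ⟨_, .inr ⟨rfl, h⟩⟩

/-- An equivalence relation `R` on `X` is a weak time-abstract bisimulation for `α` iff
there is a saturated map `β : X/R → 𝒫(Σ_τ × X/R)` with `f^♯ ∘ W = β ∘ f^♯`, where `W` is
the time-abstract saturated step map of `α` and `f` the quotient map. -/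
theorem stmt12 {Act T X : Type*} [AddCommMonoid T]
    (α : X → Set (Option Act × T × X)) (R : X → X → Prop) (hR : Equivalence R) :
    WeakTimeAbstractBisim α R ↔
      ∃ β : Quotient (⟨R, hR⟩ : Setoid X) → Set (Option Act × Quotient (⟨R, hR⟩ : Setoid X)),
        (∀ y, ((none : Option Act), y) ∈ β y) ∧
        (∀ y, kcomp β β y ⊆ β y) ∧
        kcomp (fsharp (Quotient.mk (⟨R, hR⟩ : Setoid X)))
            (fun x => {p : Option Act × X | ∃ t : T, WStep α x p.1 t p.2})
          = kcomp β (fsharp (Quotient.mk (⟨R, hR⟩ : Setoid X))) := by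
  have mk_eq {a b : X} : (Quotient.mk (⟨R, hR⟩ : Setoid X) a = Quotient.mk _ b) ↔ R a b :=
    Quotient.eq
  constructor
  · intro hb
    refine ⟨fun q => {p | ∃ x y t, Quotient.mk _ x = q ∧ Quotient.mk _ y = p.2 ∧
      WStep α x p.1 t y}, fun q => ?_, ?_, ?_⟩
    · obtain ⟨x, rfl⟩ := Quotient.exists_rep q
      exact ⟨x, x, 0, rfl, rfl, .refl x⟩
    · rintro _ ⟨σ, _⟩ ⟨_, ⟨⟨x, y, t, rfl, rfl, h⟩, ⟨x', z, s, hxy, rfl, h'⟩⟩ |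
        ⟨⟨x, y, t, rfl, rfl, h⟩, ⟨x', z, s, hxy, rfl, h'⟩⟩⟩
      · obtain ⟨w, s', hw, hzw⟩ := hb _ _ (mk_eq.1 hxy) _ _ _ h'
        obtain ⟨u, hu⟩ := h.trans_silent hw
        exact ⟨x, w, u, rfl, mk_eq.2 (hR.symm hzw), hu⟩
      · obtain ⟨w, s', hw, hzw⟩ := hb _ _ (mk_eq.1 hxy) _ _ _ h'
        obtain ⟨u, hu⟩ := h.silent_trans hw
        exact ⟨x, w, u, rfl, mk_eq.2 (hR.symm hzw), hu⟩
    · ext x ⟨σ, z⟩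
      rw [mem_kcomp_fsharp_left, kcomp_fsharp_right]
      constructor
      · rintro ⟨y, ⟨t, h⟩, rfl⟩
        exact ⟨x, y, t, rfl, rfl, h⟩
      · rintro ⟨x', y, t, hx, rfl, h⟩
        obtain ⟨y', t', h', hy⟩ := hb _ _ (mk_eq.1 hx) _ _ _ h
        exact ⟨y', ⟨t', h'⟩, mk_eq.2 (hR.symm hy)⟩
  · rintro ⟨β, -, -, hβ⟩ x y hxy σ t x' h
    have hx := (mem_kcomp_fsharp_left (Quotient.mk (⟨R, hR⟩ : Setoid X))
      (fun x => {p : Option Act × X | ∃ t : T, WStep α x p.1 t p.2}) x σ _).2 ⟨x', ⟨t, h⟩, rfl⟩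
    rw [hβ, kcomp_fsharp_right, mk_eq.2 hxy, ← kcomp_fsharp_right (Quotient.mk _) β y, ← hβ,
      mem_kcomp_fsharp_left] at hx
    obtain ⟨y', ⟨t', h'⟩, hy⟩ := hx
    exact ⟨y', t', h', hR.symm (mk_eq.1 hy)⟩
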